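/- For every u ∈ S_n, Y_{≥u} = Y ∩ G_0 u; that is, a totally nonnegative upper unitriangular matrix x lies in some stratum Y°_v with v ≥ u in the Bruhat order if and only if x u⁻¹ admits a Gaussian decomposition. -/

import Mathlib

open scoped Classical

namespace BruhatTNN

abbrev Mat (n : ℕ) := Matrix (Fin n) (Fin n) ℝ

/-- `x` is upper unitriangular. -/
def upperUni {n : ℕ} (x : Mat n) : Prop :=
  (∀ i, x i i = 1) ∧ ∀ i j : Fin n, j < i → x i j = 0

/-- `x` is lower unitriangular. -/
def lowerUni {n : ℕ} (x : Mat n) : Prop :=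
  (∀ i, x i i = 1) ∧ ∀ i j : Fin n, i < j → x i j = 0

/-- `x` is invertible upper triangular (`x ∈ B`). -/
def upperTriInv {n : ℕ} (x : Mat n) : Prop :=
  IsUnit x.det ∧ ∀ i j : Fin n, j < i → x i j = 0

/-- `x` is invertible lower triangular (`x ∈ B_-`). -/
def lowerTriInv {n : ℕ} (x : Mat n) : Prop :=
  IsUnit x.det ∧ ∀ i j : Fin n, i < j → x i j = 0

/-- `x` is invertible diagonal (`x ∈ H`). -/
def diagInv {n : ℕ} (x : Mat n) : Prop :=
  IsUnit x.det ∧ ∀ i j : Fin n, i ≠ j → x i j = 0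

/-- `x` admits a Gaussian decomposition (`x ∈ G_0`). -/
def hasGauss {n : ℕ} (x : Mat n) : Prop :=
  ∃ a d b : Mat n, lowerUni a ∧ diagInv d ∧ upperUni b ∧ x = a * d * b

/-- The factor `[x]_-` of the Gaussian decomposition (junk value `1` if none exists). -/
noncomputable def gaussMinus {n : ℕ} (x : Mat n) : Mat n :=
  if h : hasGauss x then h.choose else 1

/-- The factor `[x]_0` of the Gaussian decomposition (junk value `1` if none exists). -/
noncomputable def gaussDiag {n : ℕ} (x : Mat n) : Mat n :=
  if h : hasGauss x then h.choose_spec.choose else 1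

/-- The factor `[x]_+` of the Gaussian decomposition (junk value `1` if none exists). -/
noncomputable def gaussPlus {n : ℕ} (x : Mat n) : Mat n :=
  if h : hasGauss x then h.choose_spec.choose_spec.choose else 1

/-- The permutation matrix of `w`, with entry `1` in position `(w j, j)`. -/
def permMat {n : ℕ} (w : Equiv.Perm (Fin n)) : Mat n :=
  Matrix.of fun i j => if i = w j then (1 : ℝ) else 0

/-- The minor of `x` with row set `I` and column set `J` (taken in increasing order). -/
def minorOf {n : ℕ} (x : Mat n) (k : ℕ) (I J : Finset (Fin n))
    (hI : I.card = k) (hJ : J.card = k) : ℝ :=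
  Matrix.det (Matrix.of fun a b : Fin k => x (I.orderEmbOfFin hI a) (J.orderEmbOfFin hJ b))

/-- `x` is totally nonnegative: all its minors are nonnegative. -/
def totNonneg {n : ℕ} (x : Mat n) : Prop :=
  ∀ (k : ℕ) (I J : Finset (Fin n)) (hI : I.card = k) (hJ : J.card = k),
    0 ≤ minorOf x k I J hI hJ

/-- The Bruhat order on the symmetric group. -/
def bruhatLE {n : ℕ} (u v : Equiv.Perm (Fin n)) : Prop :=
  ∀ i j : Fin n,
    (Finset.univ.filter fun k : Fin n => k ≤ i ∧ j ≤ u k).card ≤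
    (Finset.univ.filter fun k : Fin n => k ≤ i ∧ j ≤ v k).card

/-- The double coset `B_- w B_-`. -/
def doubleCosetBm {n : ℕ} (w : Equiv.Perm (Fin n)) : Set (Mat n) :=
  {x | ∃ b₁ b₂ : Mat n, lowerTriInv b₁ ∧ lowerTriInv b₂ ∧ x = b₁ * permMat w * b₂}

/-- `N^w = B_- w B_- ∩ N`. -/
def Ncell {n : ℕ} (w : Equiv.Perm (Fin n)) : Set (Mat n) :=
  {x | upperUni x ∧ x ∈ doubleCosetBm w}

/-- `N_-(w) = w⁻¹ N w ∩ N_-`. -/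
def Nminus {n : ℕ} (w : Equiv.Perm (Fin n)) : Set (Mat n) :=
  {x | lowerUni x ∧ ∃ y : Mat n, upperUni y ∧ x = permMat w⁻¹ * y * permMat w}

/-- `N(w) = w⁻¹ N w ∩ N`. -/
def Ngrp {n : ℕ} (w : Equiv.Perm (Fin n)) : Set (Mat n) :=
  {x | upperUni x ∧ ∃ y : Mat n, upperUni y ∧ x = permMat w⁻¹ * y * permMat w}

/-- The totally positive cell `Y°_w = Y ∩ B_- w B_-`. -/
def Ycirc {n : ℕ} (w : Equiv.Perm (Fin n)) : Set (Mat n) :=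
  {x | upperUni x ∧ totNonneg x ∧ x ∈ doubleCosetBm w}

/-- `Y_{≥ u} = ⋃_{v ≥ u} Y°_v`. -/
def Yge {n : ℕ} (u : Equiv.Perm (Fin n)) : Set (Mat n) :=
  {x | ∃ v, bruhatLE u v ∧ x ∈ Ycirc v}

/-- `A = u⁻¹ [x u⁻¹]_+ u`. -/
noncomputable def Amat {n : ℕ} (u : Equiv.Perm (Fin n)) (x : Mat n) : Mat n :=
  permMat u⁻¹ * gaussPlus (x * permMat u⁻¹) * permMat u

/-- The projection `π_u(x) = [u [u⁻¹ [x u⁻¹]_+ u]_-]_+`. -/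
noncomputable def piMap {n : ℕ} (u : Equiv.Perm (Fin n)) (x : Mat n) : Mat n :=
  gaussPlus (permMat u * gaussMinus (Amat u x))

/-- `str(M)`: the sum of the matrix entries immediately above the main diagonal. -/
def strAbove {n : ℕ} (M : Mat n) : ℝ :=
  ∑ p : Fin n × Fin n, if (p.1 : ℕ) + 1 = (p.2 : ℕ) then M p.1 p.2 else 0

/-- The number of inversions (the length) of a permutation. -/
def invNum {n : ℕ} (w : Equiv.Perm (Fin n)) : ℕ :=
  (Finset.univ.filter fun p : Fin n × Fin n => p.1 < p.2 ∧ w p.2 < w p.1).card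

/-- The signed maximal minors of a `k × (k + 1)` matrix are a linear relation of its columns. -/
theorem sum_signed_minors_mul_eq_zero {k : ℕ} (A : Matrix (Fin k) (Fin (k + 1)) ℝ) (i : Fin k) :
    ∑ t : Fin (k + 1), (-1 : ℝ) ^ (t : ℕ) * (A.submatrix id t.succAbove).det * A i t = 0 := by
  have h : (Matrix.of (Fin.cons (A i) A : Fin (k + 1) → Fin (k + 1) → ℝ)).det = 0 := by
    refine Matrix.det_zero_of_row_eq (i := 0) (j := i.succ) (Fin.succ_ne_zero i).symm ?_
    rfl
  rw [Matrix.det_succ_row_zero] at h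
  rw [← h]
  refine Finset.sum_congr rfl fun t _ => ?_
  have : ((Matrix.of (Fin.cons (A i) A : Fin (k + 1) → Fin (k + 1) → ℝ)).submatrix Fin.succ
      t.succAbove) = A.submatrix id t.succAbove := by
    rfl
  rw [this]
  rw [mul_right_comm]
  rfl

/-- The three-term Plücker relation relating the maximal minors of a matrix with those of the
matrix without its last row. -/
theorem three_term_relation {q : ℕ} (A : Matrix (Fin (q + 2)) (Fin (q + 3)) ℝ) (m : Fin (q + 1)) :
    (A.submatrix id m.castSucc.castSucc.succAbove).det *
        (A.submatrix Fin.castSucc (Fin.castSucc ∘ m.succ.succAbove)).det +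
      (A.submatrix id (Fin.last (q + 2)).succAbove).det *
        (A.submatrix Fin.castSucc
          (m.castSucc.castSucc.succAbove ∘ m.castSucc.succAbove)).det =
      (A.submatrix id m.succ.castSucc.succAbove).det *
        (A.submatrix Fin.castSucc (Fin.castSucc ∘ m.castSucc.succAbove)).det := by
  set S : Fin q → Fin (q + 3) := fun t => (m.castSucc.succAbove (m.succAbove t)).castSucc with hS
  set w : Fin (q + 1) → ℝ := fun i =>
    (-1) ^ (i : ℕ) * (A.submatrix (Fin.castSucc ∘ i.succAbove) S).det with hw
  set D : Fin (q + 3) → ℝ := fun t => (A.submatrix id t.succAbove).det with hD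
  set L : Fin (q + 3) → ℝ := fun v => ∑ i, w i * A i.castSucc v with hL
  have expand : ∀ (f : Fin (q + 1) → Fin (q + 3)) (j : Fin (q + 1)),
      (∀ t, f (j.succAbove t) = S t) →
      (A.submatrix Fin.castSucc f).det = (-1) ^ (j : ℕ) * L (f j) := by
    intro f j hf
    rw [Matrix.det_succ_column _ j, hL, Finset.mul_sum]
    refine Finset.sum_congr rfl fun i _ => ?_
    have : (A.submatrix Fin.castSucc f).submatrix i.succAbove j.succAbove =
        A.submatrix (Fin.castSucc ∘ i.succAbove) S := by
      ext a b; simp [hf]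
    rw [this, hw]
    simp only [Matrix.submatrix_apply]
    ring
  have LS : ∀ t, L (S t) = 0 := by
    intro t
    have h := expand (Fin.cons (S t) S) 0 (by intro t; simp)
    rw [Matrix.det_zero_of_column_eq (i := 0) (j := t.succ) (Fin.succ_ne_zero t).symm] at h
    · simpa using h.symm
    · intro i; simp
  have hp := expand (Fin.castSucc ∘ m.succ.succAbove) m (by
    intro t
    simp only [Function.comp, hS]
    congr 1
    ext
    simp only [Fin.succAbove, Fin.lt_def, apply_ite Fin.val, Fin.val_castSucc, Fin.val_succ]
    split_ifs <;> omega)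
  have hj := expand (Fin.castSucc ∘ m.castSucc.succAbove) m (by
    intro t; simp [hS])
  have hl := expand (m.castSucc.castSucc.succAbove ∘ m.castSucc.succAbove) (Fin.last q) (by
    intro t
    simp only [Function.comp, hS, Fin.succAbove_last, Fin.castSucc_succAbove_castSucc])
  have e1 : m.succ.succAbove m = m.castSucc := by simp
  have e2 : m.castSucc.succAbove m = m.succ := by simp
  have e3 : m.castSucc.succAbove (Fin.last q) = Fin.last (q + 1) := by
    rw [Fin.succAbove_of_le_castSucc _ _ (by simp [Fin.le_def]; omega)]; simp
  have e4 : m.castSucc.castSucc.succAbove (Fin.last (q + 1)) = Fin.last (q + 2) := by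
    rw [Fin.succAbove_of_le_castSucc _ _ (by simp [Fin.le_def])]; simp
  simp only [Function.comp_apply, e1, e2, e3, e4] at hp hj hl
  have key : ∑ t : Fin (q + 3), (-1 : ℝ) ^ (t : ℕ) * D t * L t = 0 := by
    simp only [hL, Finset.mul_sum]
    rw [Finset.sum_comm]
    refine Finset.sum_eq_zero fun i _ => ?_
    have h := sum_signed_minors_mul_eq_zero A i.castSucc
    calc _ = w i * ∑ t : Fin (q + 3), (-1 : ℝ) ^ (t : ℕ) * D t * A i.castSucc t := by
          rw [Finset.mul_sum]; exact Finset.sum_congr rfl fun t _ => by ring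
      _ = 0 := by rw [hD, h, mul_zero]
  rw [Fin.sum_univ_castSucc, Fin.sum_univ_succAbove _ m.castSucc, Fin.sum_univ_succAbove _ m,
    Finset.sum_eq_zero (s := Finset.univ (α := Fin q))
      (fun t _ => by rw [LS t, mul_zero])] at key
  rw [hp, hj]
  simp only [Function.comp_def] at hl ⊢
  rw [hl]
  simp only [e2, Fin.val_castSucc, Fin.val_succ, Fin.val_last] at key ⊢
  have hq : ((-1 : ℝ) ^ q) = (-1) ^ (q + 2) := by ring
  rw [hq]
  change D _ * _ + D _ * _ = D _ * _
  linear_combination key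

/-- A minor on the first `k` rows. -/
noncomputable def topMinor {n k : ℕ} (x : Mat n) (h : k ≤ n) (c : Fin k → Fin n) : ℝ :=
  (x.submatrix (Fin.castLE h) c).det

theorem totNonneg.det_submatrix_nonneg {n k : ℕ} {x : Mat n} (hx : totNonneg x)
    {r c : Fin k → Fin n} (hr : StrictMono r) (hc : StrictMono c) :
    0 ≤ (x.submatrix r c).det := by
  have hI : (Finset.univ.image r).card = k := by
    rw [Finset.card_image_of_injective _ hr.injective]; simp
  have hJ : (Finset.univ.image c).card = k := by
    rw [Finset.card_image_of_injective _ hc.injective]; simp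
  have h := hx k _ _ hI hJ
  unfold minorOf at h
  rw [← Finset.orderEmbOfFin_unique hI (f := r) (by simp) hr,
    ← Finset.orderEmbOfFin_unique hJ (f := c) (by simp) hc] at h
  exact h

theorem val_le_apply_of_strictMono {k n : ℕ} {f : Fin k → Fin n} (hf : StrictMono f) (i : Fin k) :
    (i : ℕ) ≤ f i := by
  obtain ⟨i, hi⟩ := i
  induction i with
  | zero => simp
  | succ i ih =>
    have h1 := ih (by omega)
    have h2 : f ⟨i, by omega⟩ < f ⟨i + 1, hi⟩ := hf (by simp [Fin.lt_def])
    rw [Fin.lt_def] at h2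
    simp only at h1 h2 ⊢
    omega

/-- Moving the last column of a positive top minor to the left keeps it positive. -/
theorem topMinor_pos_of_move_last {n k : ℕ} {x : Mat n} (hx : upperUni x) (ht : totNonneg x)
    (h : k + 1 ≤ n) {c : Fin (k + 2) → Fin n} (hc : StrictMono c)
    (hpos : 0 < topMinor x h (c ∘ (Fin.last k).castSucc.succAbove)) :
    0 < topMinor x h (c ∘ Fin.castSucc) := by
  set p : Fin n := c (Fin.last k).castSucc with hp
  have hkp : k ≤ (p : ℕ) := by simpa using val_le_apply_of_strictMono hc (Fin.last k).castSucc
  rcases hkp.eq_or_lt with hkp | hkp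
  · have hci : ∀ i : Fin (k + 1), c i.castSucc = Fin.castLE h i := by
      have aux : ∀ d : ℕ, ∀ i : Fin (k + 1), (i : ℕ) + d = k → (c i.castSucc : ℕ) ≤ i := by
        intro d
        induction d with
        | zero =>
          intro i hi
          have : i = Fin.last k := Fin.ext (by simpa using hi)
          rw [this, ← hp, ← hkp]; simp
        | succ d ih =>
          intro i hi
          have h1 := ih ⟨i + 1, by omega⟩ (by simp; omega)
          have h2 : c i.castSucc < c (Fin.castSucc ⟨i + 1, by omega⟩) := hc (by simp [Fin.lt_def])
          rw [Fin.lt_def] at h2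
          simp only at h1
          omega
      intro i
      ext
      have h1 := aux (k - i) i (by omega)
      have h2 := val_le_apply_of_strictMono hc i.castSucc
      simp at h2 ⊢
      omega
    unfold topMinor
    rw [Matrix.det_of_isUpperTriangular]
    · refine Finset.prod_pos fun i _ => ?_
      simp [hci, hx.1]
    · intro i j hij
      simp only [Matrix.submatrix_apply, Function.comp, hci]
      exact hx.2 _ _ hij
  · have hr : StrictMono (Fin.snoc (Fin.castLE h) p : Fin (k + 2) → Fin n) := by
      rw [Fin.strictMono_iff_lt_succ]
      intro i
      refine Fin.lastCases ?_ (fun i => ?_) i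
      · rw [Fin.succ_last, Fin.snoc_last, Fin.snoc_castSucc]
        simp [Fin.lt_def]; omega
      · rw [Fin.succ_castSucc, Fin.snoc_castSucc, Fin.snoc_castSucc]
        simp [Fin.lt_def]
    have h0 := ht.det_submatrix_nonneg hr hc
    rw [Matrix.det_succ_row _ (Fin.last (k + 1)), Fin.sum_univ_castSucc, Fin.sum_univ_castSucc,
      Finset.sum_eq_zero] at h0
    · have e : ∀ f : Fin (k + 1) → Fin (k + 2),
          ((x.submatrix (Fin.snoc (Fin.castLE h) p : Fin (k + 2) → Fin n) c).submatrix
            (Fin.last (k + 1)).succAbove f).det = topMinor x h (c ∘ f) := by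
        intro f
        unfold topMinor
        congr 1
        ext a b
        simp
      rw [e, e] at h0
      simp only [Matrix.submatrix_apply, Fin.snoc_last, ← hp, hx.1, Fin.val_last,
        Fin.val_castSucc] at h0
      have hs : ((-1 : ℝ) ^ (k + 1 + k)) = -1 := by
        rw [show k + 1 + k = 2 * k + 1 by ring]; simp [pow_succ, pow_mul]
      have hs' : ((-1 : ℝ) ^ (k + 1 + (k + 1))) = 1 := by
        rw [show k + 1 + (k + 1) = 2 * (k + 1) by ring]; simp [pow_mul]
      rw [hs, hs'] at h0
      have hl : (Fin.last (k + 1)).succAbove = Fin.castSucc := by ext; simp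
      rw [hl] at h0
      have hnn : 0 ≤ topMinor x h (c ∘ Fin.castSucc) :=
        ht.det_submatrix_nonneg (Fin.strictMono_castLE h) (hc.comp Fin.strictMono_castSucc)
      refine lt_of_le_of_ne hnn fun h00 => ?_
      rw [← h00] at h0
      linarith
    · intro i _
      rw [Matrix.submatrix_apply, Fin.snoc_last, hx.2 _ _ (hc (by simp [Fin.lt_def]))]
      simp

/-- Nonvanishing of top minors is inherited by smaller column sets. -/
theorem topMinor_pos_of_le {n : ℕ} {x : Mat n} (hx : upperUni x) (ht : totNonneg x) :
    ∀ {k : ℕ} (h : k ≤ n) {f g : Fin k → Fin n}, StrictMono f → StrictMono g → f ≤ g →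
      topMinor x h g ≠ 0 → 0 < topMinor x h f := by
  intro k
  induction k with
  | zero => intro h f g _ _ _ _; simp [topMinor]
  | succ k ih =>
    intro h f g hf hg hfg hne
    have drop : ∀ {f : Fin k → Fin n} {g : Fin (k + 1) → Fin n}, StrictMono f → StrictMono g →
        f ≤ g ∘ Fin.castSucc → topMinor x h g ≠ 0 → 0 < topMinor x (by omega : k ≤ n) f := by
      intro f g hf hg hfg hne
      unfold topMinor at hne
      rw [Matrix.det_succ_row _ (Fin.last k)] at hne
      obtain ⟨t, -, htne⟩ := Finset.exists_ne_zero_of_sum_ne_zero hne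
      refine ih _ hf (hg.comp (Fin.strictMono_succAbove t)) (g := g ∘ t.succAbove) ?_ ?_
      · intro i
        refine (hfg i).trans (hg.monotone ?_)
        simp only [Fin.succAbove, Fin.le_def]; split_ifs <;> simp
      · have := right_ne_zero_of_mul htne
        convert this using 1
        unfold topMinor
        congr 1
        ext a b
        simp only [Matrix.submatrix_apply, Fin.succAbove_last]
        rfl
    have step : ∀ {c : Fin (k + 2) → Fin n} (m : Fin (k + 1)), StrictMono c →
        0 < topMinor x h (c ∘ m.castSucc.succAbove) →
        0 < topMinor x h (c ∘ m.succ.succAbove) := by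
      intro c m hc hpos
      induction m using Fin.lastCases with
      | last =>
        have := topMinor_pos_of_move_last hx ht h hc hpos
        convert this using 2
        ext; simp
      | cast m =>
        obtain ⟨q, rfl⟩ : ∃ q, k = q + 1 := ⟨k - 1, by have := m.2; omega⟩
        have nn : ∀ {l : ℕ} (hl : l ≤ n) {e : Fin l → Fin (q + 3)}, StrictMono e →
            0 ≤ topMinor x hl (c ∘ e) := fun hl _ he =>
          ht.det_submatrix_nonneg (Fin.strictMono_castLE hl) (hc.comp he)
        have T := three_term_relation (x.submatrix (Fin.castLE h) c) m
        have c1 : ∀ e, ((x.submatrix (Fin.castLE h) c).submatrix id e).det =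
            topMinor x h (c ∘ e) := fun _ => rfl
        have c2 : ∀ e, ((x.submatrix (Fin.castLE h) c).submatrix Fin.castSucc e).det =
            topMinor x (by omega : q + 1 ≤ n) (c ∘ e) := fun _ => rfl
        simp only [c1, c2] at T
        have a1 := drop (f := c ∘ Fin.castSucc ∘ m.succ.succAbove)
          (hc.comp (Fin.strictMono_castSucc.comp (Fin.strictMono_succAbove _)))
          (hc.comp (Fin.strictMono_succAbove m.castSucc.castSucc)) (by
            intro i
            refine hc.monotone ?_
            simp only [Function.comp, Fin.succAbove, Fin.le_def, Fin.lt_def, apply_ite Fin.val,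
              Fin.val_castSucc, Fin.val_succ]
            split_ifs <;> omega) hpos.ne'
        have a2 := nn h (Fin.strictMono_succAbove (Fin.last (q + 2)))
        have a3 := nn (by omega : q + 1 ≤ n) ((Fin.strictMono_succAbove m.castSucc.castSucc).comp
          (Fin.strictMono_succAbove m.castSucc))
        have a4 := nn h (Fin.strictMono_succAbove m.castSucc.succ)
        refine lt_of_le_of_ne a4 fun h0 => ?_
        rw [Fin.succ_castSucc] at h0
        rw [← h0, zero_mul] at T
        nlinarith [mul_pos hpos a1, mul_nonneg a2 a3]
    set H : ℕ → Fin (k + 1) → Fin n := fun m i => if (i : ℕ) < m then f i else g i with hH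
    have hHmono : ∀ m, StrictMono (H m) := by
      intro m i j hij
      have h1 := hf hij
      have h2 := hg hij
      have h3 := hfg i
      simp only [hH]
      split_ifs with h4 h5 h5
      · exact h1
      · exact lt_of_le_of_lt h3 h2
      · rw [Fin.lt_def] at hij; omega
      · exact h2
    have main : ∀ m, m ≤ k + 1 → 0 < topMinor x h (H m) := by
      intro m
      induction m with
      | zero =>
        intro _
        have : H 0 = g := by ext; simp [hH]
        rw [this]
        exact lt_of_le_of_ne
          (ht.det_submatrix_nonneg (Fin.strictMono_castLE h) hg) (Ne.symm hne)
      | succ m ihm =>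
        intro hm
        have ihm := ihm (by omega)
        rcases (hfg ⟨m, by omega⟩).eq_or_lt with heq | hlt
        · have : H (m + 1) = H m := by
            funext i
            simp only [hH]
            by_cases h1 : (i : ℕ) < m
            · simp [h1, Nat.lt_succ_of_lt h1]
            · by_cases h2 : (i : ℕ) = m
              · have : i = ⟨m, by omega⟩ := Fin.ext h2
                simp [this, heq]
              · rw [if_neg (by omega), if_neg h1]
          rw [this]; exact ihm
        · set c : Fin (k + 2) → Fin n := fun i =>
            if hi : (i : ℕ) ≤ m then f ⟨i, by omega⟩ else g ⟨i - 1, by omega⟩ with hcdef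
          have hc : StrictMono c := by
            intro i j hij
            rw [Fin.lt_def] at hij
            simp only [hcdef]
            split_ifs with h4 h5 h5
            · exact hf hij
            · refine lt_of_le_of_lt (hf.monotone ?_) (lt_of_lt_of_le hlt (hg.monotone ?_))
              · simpa [Fin.le_def] using h4
              · simp [Fin.le_def]; omega
            · omega
            · exact hg (by simp [Fin.lt_def]; omega)
          have s1 : c ∘ (⟨m, by omega⟩ : Fin (k + 1)).castSucc.succAbove = H m := by
            funext i
            simp only [hcdef, hH, Function.comp, Fin.succAbove, Fin.lt_def, Fin.val_castSucc]
            by_cases h1 : (i : ℕ) < m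
            · simp [h1, h1.le]
            · simp [h1, show ¬ (i : ℕ) + 1 ≤ m by omega]
          have s2 : c ∘ (⟨m, by omega⟩ : Fin (k + 1)).succ.succAbove = H (m + 1) := by
            funext i
            simp only [hcdef, hH, Function.comp, Fin.succAbove, Fin.lt_def, Fin.val_castSucc,
              Fin.val_succ]
            by_cases h1 : (i : ℕ) < m + 1
            · simp [h1, Nat.lt_succ_iff.mp h1]
            · simp [h1, show ¬ (i : ℕ) + 1 ≤ m by omega]
          rw [← s2]
          refine step _ hc ?_
          rw [s1]
          exact ihm
    have := main (k + 1) le_rfl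
    have e : H (k + 1) = f := by
      funext i
      exact if_pos i.2
    rwa [e] at this

theorem permMat_apply {n : ℕ} (w : Equiv.Perm (Fin n)) (i j : Fin n) :
    permMat w i j = if i = w j then 1 else 0 := by
  simp only [permMat, Matrix.of_apply]

theorem permMat_mul {n : ℕ} (v w : Equiv.Perm (Fin n)) :
    permMat v * permMat w = permMat (v * w) := by
  ext i j
  rw [Matrix.mul_apply, Finset.sum_eq_single (w j)]
  · rw [permMat_apply, permMat_apply, permMat_apply, if_pos rfl, mul_one]
    rfl
  · intro b _ hb
    simp [permMat_apply, hb]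
  · simp

theorem permMat_one {n : ℕ} : permMat (1 : Equiv.Perm (Fin n)) = 1 := by
  ext i j
  rw [permMat_apply, Matrix.one_apply]
  congr

theorem mul_permMat_apply {n : ℕ} (x : Mat n) (w : Equiv.Perm (Fin n)) (i j : Fin n) :
    (x * permMat w) i j = x i (w j) := by
  simp [permMat_apply, Matrix.mul_apply]

theorem permMat_mul_apply {n : ℕ} (x : Mat n) (w : Equiv.Perm (Fin n)) (i j : Fin n) :
    (permMat w * x) i j = x (w⁻¹ i) j := by
  rw [Matrix.mul_apply, Finset.sum_eq_single (w⁻¹ i)]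
  · simp [permMat_apply]
  · intro b _ hb
    have : i ≠ w b := fun h => hb (by simp [h])
    simp [permMat_apply, this]
  · simp

theorem det_permMat_ne_zero {n : ℕ} (w : Equiv.Perm (Fin n)) : (permMat w).det ≠ 0 := by
  have h : (permMat w).det * (permMat w⁻¹).det = 1 := by
    rw [← Matrix.det_mul, permMat_mul, mul_inv_cancel, permMat_one, Matrix.det_one]
  exact left_ne_zero_of_mul_eq_one h

theorem lowerTriInv.diag_ne_zero {n : ℕ} {b : Mat n} (hb : lowerTriInv b) (i : Fin n) :
    b i i ≠ 0 := by
  have h := hb.1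
  rw [Matrix.det_of_isLowerTriangular _ (fun i j hij => hb.2 i j hij), isUnit_iff_ne_zero,
    Finset.prod_ne_zero_iff] at h
  exact h i (Finset.mem_univ i)

theorem lowerTriInv_of_diag_ne_zero {n : ℕ} {b : Mat n} (hd : ∀ i, b i i ≠ 0)
    (hb : ∀ i j : Fin n, i < j → b i j = 0) : lowerTriInv b := by
  refine ⟨?_, hb⟩
  rw [Matrix.det_of_isLowerTriangular _ (fun i j hij => hb i j hij), isUnit_iff_ne_zero,
    Finset.prod_ne_zero_iff]
  exact fun i _ => hd i

theorem lowerTriInv.mul {n : ℕ} {a b : Mat n} (ha : lowerTriInv a) (hb : lowerTriInv b) :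
    lowerTriInv (a * b) := by
  refine ⟨by rw [Matrix.det_mul]; exact ha.1.mul hb.1, fun i j hij => ?_⟩
  rw [Matrix.mul_apply]
  refine Finset.sum_eq_zero fun k _ => ?_
  rcases lt_or_ge i k with h | h
  · rw [ha.2 i k h, zero_mul]
  · rw [hb.2 k j (lt_of_le_of_lt h hij), mul_zero]

theorem upperUni.mul {n : ℕ} {a b : Mat n} (ha : upperUni a) (hb : upperUni b) :
    upperUni (a * b) := by
  constructor
  · intro i
    rw [Matrix.mul_apply, Finset.sum_eq_single i]
    · rw [ha.1, hb.1, mul_one]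
    · intro k _ hk
      rcases lt_or_gt_of_ne hk with h | h
      · rw [ha.2 i k h, zero_mul]
      · rw [hb.2 k i h, mul_zero]
    · simp
  · intro i j hij
    rw [Matrix.mul_apply]
    refine Finset.sum_eq_zero fun k _ => ?_
    rcases lt_or_ge k i with h | h
    · rw [ha.2 i k h, zero_mul]
    · rw [hb.2 k j (lt_of_lt_of_le hij h), mul_zero]

theorem upperUni.det_eq_one {n : ℕ} {x : Mat n} (hx : upperUni x) : x.det = 1 := by
  rw [Matrix.det_of_isUpperTriangular (fun i j hij => hx.2 i j hij)]
  simp [hx.1]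

theorem upperUni_one {n : ℕ} : upperUni (1 : Mat n) :=
  ⟨fun i => Matrix.one_apply_eq i, fun _ _ h => Matrix.one_apply_ne h.ne'⟩

theorem lowerTriInv_one {n : ℕ} : lowerTriInv (1 : Mat n) :=
  ⟨by simp, fun _ _ h => Matrix.one_apply_ne h.ne⟩

/-- One round of elimination: if `r` is the first row with a nonzero entry in column `m`, then
lower row operations and upper column operations clear column `m` and row `r` except for a `1` in
position `(r, m)`. -/
theorem eliminate_column {n : ℕ} (y : Mat n) (r m : Fin n) (hrm : y r m ≠ 0)
    (hcol : ∀ i < r, y i m = 0) (hrow : ∀ j < m, y r j = 0) :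
    ∃ b z c : Mat n, lowerTriInv b ∧ upperUni c ∧ y = b * z * c ∧
      ∀ i j, z i j = if i = r then (if j = m then 1 else 0)
        else if j = m then 0 else y i j - y i m * y r j / y r m := by
  set z : Mat n := Matrix.of fun i j => if i = r then (if j = m then 1 else 0)
        else if j = m then 0 else y i j - y i m * y r j / y r m with hz
  refine ⟨Matrix.of fun i i' => if i' = r then y i m else if i = i' then 1 else 0, z,
    Matrix.of fun j' j => if j' = m then y r j / y r m else if j' = j then 1 else 0,
    lowerTriInv_of_diag_ne_zero ?_ ?_, ⟨?_, ?_⟩, ?_, fun i j => by simp [hz]⟩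
  · intro i
    by_cases h : i = r <;> simp [h, hrm]
  · intro i j hij
    by_cases h : j = r
    · subst h; simp [hcol i hij]
    · simp [h, hij.ne]
  · intro i
    by_cases h : i = m <;> simp [h, hrm]
  · intro i j hij
    by_cases h : i = m
    · subst h; simp [hrow j hij]
    · simp [h, hij.ne']
  · have hzc : ∀ i j, (z * Matrix.of fun j' j => if j' = m then y r j / y r m
        else if j' = j then 1 else 0) i j =
        if i = r then y r j / y r m else if j = m then 0
          else y i j - y i m * y r j / y r m := by
      intro i j
      rw [Matrix.mul_apply, Fintype.sum_eq_add_sum_compl m]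
      by_cases hi : i = r
      · subst hi
        rw [Finset.sum_eq_zero]
        · simp [hz]
        · intro k hk
          have : k ≠ m := by simpa using hk
          simp [hz, this]
      · by_cases hj : j = m
        · subst hj
          rw [Finset.sum_eq_zero]
          · simp [hz, hi]
          · intro k hk
            have : k ≠ j := by simpa using hk
            simp [this]
        · rw [Finset.sum_eq_single j]
          · simp [hz, hi, hj]
          · intro k hk hkj
            have : k ≠ m := by simpa using hk
            simp [this, hkj]
          · intro h; simp [hj] at h
    rw [Matrix.mul_assoc]
    ext i j
    rw [Matrix.mul_apply, Fintype.sum_eq_add_sum_compl r]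
    by_cases hi : i = r
    · subst hi
      rw [Finset.sum_eq_zero]
      · rw [hzc]; simp; field_simp
      · intro k hk
        have : k ≠ i := by simpa using hk
        simp [this, this.symm]
    · rw [Finset.sum_eq_single i]
      · rw [hzc, hzc]
        by_cases hj : j = m
        · subst hj; simp [hi, hrm]
        · simp [hi, hj]; ring
      · intro k hk hki
        have : k ≠ r := by simpa using hk
        simp [this, hki.symm]
      · intro h; simp [hi] at h

/-- Bruhat decomposition with respect to a pair of opposite triangular groups. -/
theorem exists_lower_perm_upper {n : ℕ} (y : Mat n) (hy : y.det ≠ 0) :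
    ∃ (b c : Mat n) (w : Equiv.Perm (Fin n)), lowerTriInv b ∧ upperUni c ∧
      y = b * permMat w * c := by
  have main : ∀ m : ℕ, m ≤ n → ∃ (b z c : Mat n) (f : Fin n → Fin n), lowerTriInv b ∧
      upperUni c ∧ y = b * z * c ∧
      (∀ j : Fin n, (j : ℕ) < m → ∀ i, z i j = if i = f j then 1 else 0) ∧
      (∀ j : Fin n, (j : ℕ) < m → ∀ j', z (f j) j' = if j' = j then 1 else 0) := by
    intro m
    induction m with
    | zero =>
      intro _
      exact ⟨1, y, 1, id, lowerTriInv_one, upperUni_one, by simp, by simp, by simp⟩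
    | succ m ih =>
      intro hm
      obtain ⟨b, z, c, f, hb, hc, hyz, h1, h2⟩ := ih (by omega)
      set M : Fin n := ⟨m, by omega⟩ with hM
      have hzdet : z.det ≠ 0 := by
        intro h; apply hy; rw [hyz, Matrix.det_mul, Matrix.det_mul, h]; simp
      have hex : ∃ r, z r M ≠ 0 := by
        by_contra! h
        exact hzdet (Matrix.det_eq_zero_of_column_eq_zero M h)
      obtain ⟨r, hr, hmin⟩ : ∃ r, z r M ≠ 0 ∧ ∀ i < r, z i M = 0 := by
        obtain ⟨r, hr, hmin⟩ := WellFounded.has_min (wellFounded_lt (α := Fin n))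
          {r | z r M ≠ 0} hex
        exact ⟨r, hr, fun i hi => by_contra fun h => hmin i h hi⟩
      have hrf : ∀ j : Fin n, (j : ℕ) < m → r ≠ f j := by
        intro j hj h
        apply hr
        rw [h, h2 j hj, if_neg]
        intro h'; rw [← h'] at hj; simp [hM] at hj
      have hrow : ∀ j < M, z r j = 0 := fun j hj => by
        rw [h1 j hj, if_neg (hrf j hj)]
      obtain ⟨b', z', c', hb', hc', hz, hz'⟩ := eliminate_column z r M hr hmin hrow
      refine ⟨b * b', z', c' * c, Function.update f M r, hb.mul hb', hc'.mul hc, ?_, ?_, ?_⟩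
      · rw [hyz, hz]
        simp only [Matrix.mul_assoc]
      · intro j hj i
        by_cases hjM : j = M
        · subst hjM; simp [hz']
        · have hjm : (j : ℕ) < m := by
            have : (j : ℕ) ≠ m := fun h => hjM (Fin.ext h)
            omega
          rw [Function.update_of_ne hjM]
          by_cases hi : i = r
          · simp [hz', hi, hjM, hrf j hjm]
          · simp [hz', hi, hjM, hrow j hjm, h1 j hjm]
      · intro j hj j'
        by_cases hjM : j = M
        · subst hjM; simp [hz']
        · have hjm : (j : ℕ) < m := by
            have : (j : ℕ) ≠ m := fun h => hjM (Fin.ext h)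
            omega
          rw [Function.update_of_ne hjM]
          have h3 := h2 j hjm M
          rw [if_neg (Ne.symm hjM)] at h3
          by_cases hj' : j' = M
          · simp [hz', (hrf j hjm).symm, hj', Ne.symm hjM]
          · simp [hz', (hrf j hjm).symm, hj', h3, h2 j hjm]
  obtain ⟨b, z, c, f, hb, hc, hyz, h1, h2⟩ := main n le_rfl
  have hf : Function.Injective f := by
    intro j j' hjj
    have h3 := h2 j j.2 j
    rw [hjj, h2 j' j'.2 j] at h3
    by_contra h
    simp [h] at h3
  refine ⟨b, c, Equiv.ofBijective f (Finite.injective_iff_bijective.mp hf), hb, hc, ?_⟩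
  rw [hyz]
  congr 2
  ext i j
  rw [h1 j j.2, permMat_apply]
  rfl

theorem sum_castLE_of_eq_zero {n k : ℕ} (h : k ≤ n) (F : Fin n → ℝ)
    (hF : ∀ l : Fin n, k ≤ (l : ℕ) → F l = 0) : ∑ l, F l = ∑ i : Fin k, F (Fin.castLE h i) := by
  obtain ⟨d, rfl⟩ := Nat.exists_eq_add_of_le h
  rw [Fin.sum_univ_add, Finset.sum_eq_zero (s := Finset.univ (α := Fin d)) (fun i _ => hF _ ?_),
    add_zero]
  · rfl
  · simp

theorem topMinor_lower_mul {n k : ℕ} {b : Mat n} (hb : lowerTriInv b) (M : Mat n) (h : k ≤ n)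
    (c : Fin k → Fin n) :
    topMinor (b * M) h c = topMinor b h (Fin.castLE h) * topMinor M h c := by
  unfold topMinor
  rw [← Matrix.det_mul]
  congr 1
  ext i j
  rw [Matrix.submatrix_apply, Matrix.mul_apply, Matrix.mul_apply]
  refine sum_castLE_of_eq_zero h _ fun l hl => ?_
  rw [hb.2 _ _ (by simp [Fin.lt_def]; omega), zero_mul]

theorem topMinor_mul_upper {n k : ℕ} {c : Mat n} (hc : upperUni c) (M : Mat n) (h : k ≤ n) :
    topMinor (M * c) h (Fin.castLE h) = topMinor M h (Fin.castLE h) := by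
  have h1 : topMinor c h (Fin.castLE h) = 1 := by
    unfold topMinor
    rw [Matrix.det_of_isUpperTriangular (M := c.submatrix (Fin.castLE h) (Fin.castLE h))
      (fun i j hij => hc.2 _ _ ((Fin.strictMono_castLE h) hij))]
    simp [hc.1]
  rw [← mul_one (topMinor M h _), ← h1]
  unfold topMinor
  rw [← Matrix.det_mul]
  congr 1
  ext i j
  rw [Matrix.submatrix_apply, Matrix.mul_apply, Matrix.mul_apply]
  refine sum_castLE_of_eq_zero h _ fun l hl => ?_
  rw [hc.2 _ _ (by simp [Fin.lt_def]; omega), mul_zero]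

theorem lowerTriInv.det_submatrix_ne_zero {n k : ℕ} {b : Mat n} (hb : lowerTriInv b)
    {c : Fin k → Fin n} (hc : StrictMono c) : (b.submatrix c c).det ≠ 0 := by
  rw [Matrix.det_of_isLowerTriangular (b.submatrix c c) (fun i j hij => hb.2 _ _ (hc hij)),
    Finset.prod_ne_zero_iff]
  exact fun i _ => hb.diag_ne_zero _

theorem hasGauss_iff_topMinor_ne_zero {n : ℕ} (y : Mat n) :
    hasGauss y ↔ ∀ (k : ℕ) (h : k ≤ n), topMinor y h (Fin.castLE h) ≠ 0 := by
  constructor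
  · rintro ⟨a, d, b, ha, hd, hb, rfl⟩ k h
    have ha' : lowerTriInv a :=
      lowerTriInv_of_diag_ne_zero (fun i => by rw [ha.1]; exact one_ne_zero) ha.2
    have had : lowerTriInv (a * d) := ha'.mul ⟨hd.1, fun i j hij => hd.2 i j hij.ne⟩
    rw [topMinor_mul_upper hb]
    exact had.det_submatrix_ne_zero (Fin.strictMono_castLE h)
  · intro hy
    obtain ⟨b, c, w, hb, hc, hyw⟩ := exists_lower_perm_upper y (hy n le_rfl)
    have hw : ∀ k (h : k ≤ n), topMinor (permMat w) h (Fin.castLE h) ≠ 0 := by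
      intro k h
      have := hy k h
      rw [hyw, topMinor_mul_upper hc, topMinor_lower_mul hb] at this
      exact right_ne_zero_of_mul this
    have hle : ∀ j, w j ≤ j := by
      intro j
      by_contra! hlt
      refine hw (j + 1) (by omega) (Matrix.det_eq_zero_of_column_eq_zero ⟨j, by omega⟩ fun i => ?_)
      rw [Matrix.submatrix_apply, permMat_apply, if_neg]
      intro h
      have h' := congrArg Fin.val h
      simp only [Fin.val_castLE, Fin.castLE_mk, Fin.eta] at h'
      rw [Fin.lt_def] at hlt
      omega
    have hw1 : w = 1 := by
      have aux : ∀ m : ℕ, ∀ j : Fin n, (j : ℕ) = m → w j = j := by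
        intro m
        induction m using Nat.strong_induction_on with
        | _ m ih =>
          intro j hj
          by_contra hne
          have hlt := lt_of_le_of_ne (hle j) hne
          exact hne (w.injective (ih (w j) (by rw [← hj]; exact hlt) (w j) rfl))
      exact Equiv.ext fun j => aux j j rfl
    rw [hw1, permMat_one, mul_one] at hyw
    refine ⟨Matrix.of fun i j => b i j / b j j, Matrix.diagonal fun i => b i i, c, ⟨?_, ?_⟩,
      ⟨?_, ?_⟩, hc, ?_⟩
    · intro i; simp [hb.diag_ne_zero i]
    · intro i j hij; simp [hb.2 i j hij]
    · rw [Matrix.det_diagonal, isUnit_iff_ne_zero, Finset.prod_ne_zero_iff]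
      exact fun i _ => hb.diag_ne_zero i
    · intro i j hij; exact Matrix.diagonal_apply_ne _ hij
    · rw [hyw]
      congr 1
      ext i j
      rw [Matrix.mul_diagonal, Matrix.of_apply, div_mul_cancel₀ _ (hb.diag_ne_zero j)]

/-- Bruhat decomposition with respect to the lower triangular group. -/
theorem exists_mem_doubleCosetBm {n : ℕ} (y : Mat n) (hy : y.det ≠ 0) :
    ∃ w, y ∈ doubleCosetBm w := by
  set ρ : Equiv.Perm (Fin n) := Fin.revPerm with hρ
  have hρρ : permMat ρ * permMat ρ = 1 := by
    rw [permMat_mul, ← permMat_one]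
    congr 1
    ext i
    simp [hρ]
  obtain ⟨b, c, w, hb, hc, hyw⟩ := exists_lower_perm_upper (y * permMat ρ) (by
    rw [Matrix.det_mul]; exact mul_ne_zero hy (det_permMat_ne_zero _))
  have hentry : ∀ i j, (permMat ρ * c * permMat ρ) i j = c (Fin.rev i) (Fin.rev j) := by
    intro i j
    rw [mul_permMat_apply, permMat_mul_apply]
    rfl
  refine ⟨w * ρ, b, permMat ρ * c * permMat ρ, hb, lowerTriInv_of_diag_ne_zero ?_ ?_, ?_⟩
  · intro i; rw [hentry, hc.1]; exact one_ne_zero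
  · intro i j hij; rw [hentry]; exact hc.2 _ _ (Fin.rev_lt_rev.mpr hij)
  · calc y = y * (permMat ρ * permMat ρ) := by rw [hρρ, mul_one]
      _ = (y * permMat ρ) * permMat ρ := by rw [mul_assoc]
      _ = b * permMat w * c * permMat ρ := by rw [hyw]
      _ = b * permMat w * (permMat ρ * permMat ρ) * c * permMat ρ := by rw [hρρ, mul_one]
      _ = b * permMat (w * ρ) * (permMat ρ * c * permMat ρ) := by
        rw [← permMat_mul]; simp only [mul_assoc]

/-- The rank conditions defining the Bruhat order, in terms of the first `k` values of the
inverse permutations. -/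
theorem bruhatLE_iff_card_inv {n : ℕ} (u v : Equiv.Perm (Fin n)) :
    bruhatLE u v ↔ ∀ (k : ℕ) (h : k ≤ n) (i : Fin n),
      (Finset.univ.filter fun a : Fin k => v⁻¹ (Fin.castLE h a) ≤ i).card ≤
      (Finset.univ.filter fun a : Fin k => u⁻¹ (Fin.castLE h a) ≤ i).card := by
  have hcard : ∀ (w : Equiv.Perm (Fin n)) (k : ℕ) (h : k ≤ n) (i : Fin n),
      (Finset.univ.filter fun a : Fin k => w⁻¹ (Fin.castLE h a) ≤ i).card +
      (Finset.univ.filter fun b : Fin n => b ≤ i ∧ k ≤ (w b : ℕ)).card =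
      (Finset.univ.filter fun b : Fin n => b ≤ i).card := by
    intro w k h i
    rw [← Finset.card_filter_add_card_filter_not (s := Finset.univ.filter fun b : Fin n => b ≤ i)
      (fun b => (w b : ℕ) < k), Finset.filter_filter, Finset.filter_filter]
    congr 1
    · refine Finset.card_bij (fun a _ => w⁻¹ (Fin.castLE h a)) ?_ ?_ ?_
      · intro a ha
        simpa using ha
      · intro a _ a' _ haa
        simpa using haa
      · intro b hb
        simp only [Finset.mem_filter, Finset.mem_univ, true_and] at hb
        refine ⟨⟨w b, hb.2⟩, ?_, ?_⟩ <;> simp [hb.1]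
    · congr 1
      ext b
      simp
  constructor
  · intro huv k h i
    rcases h.eq_or_lt with rfl | hk
    · have hu := hcard u k le_rfl i
      have hv := hcard v k le_rfl i
      have e : ∀ w : Equiv.Perm (Fin k),
          (Finset.univ.filter fun b : Fin k => b ≤ i ∧ k ≤ (w b : ℕ)).card = 0 := by
        intro w
        rw [Finset.card_eq_zero, Finset.filter_eq_empty_iff]
        intro b _ hb
        have := (w b).2
        omega
      rw [e] at hu hv
      exact le_of_eq (by omega)
    · have hu := hcard u k h i
      have hv := hcard v k h i
      have := huv i ⟨k, hk⟩
      simp only [Fin.le_def] at this hu hv ⊢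
      omega
  · intro H i j
    have hu := hcard u j j.2.le i
    have hv := hcard v j j.2.le i
    have := H j j.2.le i
    simp only [Fin.le_def] at this hu hv ⊢
    omega

theorem topMinor_mul_permMat {n k : ℕ} (x : Mat n) (w : Equiv.Perm (Fin n)) (h : k ≤ n)
    (c : Fin k → Fin n) : topMinor (x * permMat w) h c = topMinor x h (w ∘ c) := by
  unfold topMinor
  congr 1
  ext i j
  simp [mul_permMat_apply]

theorem topMinor_permMat_mul {n k : ℕ} (x : Mat n) (w : Equiv.Perm (Fin n)) (h : k ≤ n)
    (c : Fin k → Fin n) :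
    topMinor (permMat w * x) h c = (x.submatrix (⇑(w⁻¹) ∘ Fin.castLE h) c).det := by
  unfold topMinor
  congr 1
  ext i j
  simp [permMat_mul_apply]

theorem det_submatrix_comp_perm_ne_zero {n k : ℕ} (x : Mat n) (r c : Fin k → Fin n)
    (σ : Equiv.Perm (Fin k)) :
    (x.submatrix r (c ∘ σ)).det ≠ 0 ↔ (x.submatrix r c).det ≠ 0 := by
  have := Matrix.det_permute' σ (x.submatrix r c)
  rw [Matrix.submatrix_submatrix, Function.comp_id] at this
  rw [this]
  rcases Int.units_eq_one_or (Equiv.Perm.sign σ) with h | h <;> simp [h]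

theorem bruhatLE_of_topMinor_ne_zero {n : ℕ} {u v : Equiv.Perm (Fin n)} {x : Mat n}
    (hx : x ∈ doubleCosetBm v)
    (hu : ∀ (k : ℕ) (h : k ≤ n), topMinor x h (⇑(u⁻¹) ∘ Fin.castLE h) ≠ 0) : bruhatLE u v := by
  obtain ⟨b₁, b₂, hb₁, hb₂, rfl⟩ := hx
  rw [bruhatLE_iff_card_inv]
  intro k h i
  have hne := hu k h
  rw [mul_assoc, topMinor_lower_mul hb₁, topMinor_permMat_mul] at hne
  have hne := right_ne_zero_of_mul hne
  rw [Matrix.det_apply] at hne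
  obtain ⟨σ, -, hσ⟩ := Finset.exists_ne_zero_of_sum_ne_zero hne
  have hprod : ∏ a, (b₂.submatrix (⇑(v⁻¹) ∘ Fin.castLE h) (⇑(u⁻¹) ∘ Fin.castLE h)) (σ a) a ≠ 0 :=
    fun h0 => hσ (by rw [h0, smul_zero])
  rw [Finset.prod_ne_zero_iff] at hprod
  have hle : ∀ a, u⁻¹ (Fin.castLE h a) ≤ v⁻¹ (Fin.castLE h (σ a)) := fun a => by
    by_contra! hlt
    exact hprod a (Finset.mem_univ a) (hb₂.2 _ _ hlt)
  refine Finset.card_le_card_of_injOn σ.symm ?_ σ.symm.injective.injOn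
  intro a ha
  simp only [Finset.coe_filter, Finset.mem_univ, true_and, Set.mem_ofPred_eq] at ha ⊢
  exact (by simpa using hle (σ.symm a) : _ ≤ v⁻¹ (Fin.castLE h a)).trans ha

theorem exists_perm_strictMono_comp {n k : ℕ} {a : Fin k → Fin n} (ha : Function.Injective a) :
    ∃ σ : Equiv.Perm (Fin k), StrictMono (a ∘ σ) :=
  ⟨Tuple.sort a, (Tuple.monotone_sort a).strictMono_of_injective
    (ha.comp (Tuple.sort a).injective)⟩

theorem topMinor_ne_zero_of_bruhatLE {n : ℕ} {u v : Equiv.Perm (Fin n)} {x : Mat n}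
    (hx : upperUni x) (ht : totNonneg x) (hv : x ∈ doubleCosetBm v) (huv : bruhatLE u v)
    {k : ℕ} (h : k ≤ n) : topMinor x h (⇑(u⁻¹) ∘ Fin.castLE h) ≠ 0 := by
  have hinj : ∀ w : Equiv.Perm (Fin n), Function.Injective (⇑(w⁻¹) ∘ Fin.castLE h) := fun w =>
    (w⁻¹).injective.comp (Fin.castLE_injective h)
  obtain ⟨σ, hσ⟩ := exists_perm_strictMono_comp (hinj u)
  obtain ⟨τ, hτ⟩ := exists_perm_strictMono_comp (hinj v)
  have hcard : ∀ (w : Equiv.Perm (Fin n)) (π : Equiv.Perm (Fin k)) (i : Fin n),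
      (Finset.univ.filter fun a : Fin k => ((⇑(w⁻¹) ∘ Fin.castLE h) ∘ π) a ≤ i).card =
      (Finset.univ.filter fun a : Fin k => w⁻¹ (Fin.castLE h a) ≤ i).card := by
    intro w π i
    refine Finset.card_bij (fun a _ => π a) (fun a ha => by simpa using ha)
      (fun a _ a' _ haa => π.injective haa) fun b hb => ⟨π.symm b, by simpa using hb, by simp⟩
  have hle : (⇑(u⁻¹) ∘ Fin.castLE h) ∘ σ ≤ (⇑(v⁻¹) ∘ Fin.castLE h) ∘ τ := by
    intro a
    rw [← Tuple.lt_card_le_iff_apply_le_of_monotone hσ.monotone, hcard]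
    refine lt_of_lt_of_le ?_ ((bruhatLE_iff_card_inv u v).mp huv k h _)
    rw [← hcard v τ, Tuple.lt_card_le_iff_apply_le_of_monotone hτ.monotone]
  have hvne : topMinor x h ((⇑(v⁻¹) ∘ Fin.castLE h) ∘ τ) ≠ 0 := by
    obtain ⟨b₁, b₂, hb₁, hb₂, rfl⟩ := hv
    rw [mul_assoc, topMinor_lower_mul hb₁, topMinor_permMat_mul]
    refine mul_ne_zero (hb₁.det_submatrix_ne_zero (Fin.strictMono_castLE h)) ?_
    have h1 := hb₂.det_submatrix_ne_zero hτ
    rw [← Matrix.det_submatrix_equiv_self τ.symm, Matrix.submatrix_submatrix] at h1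
    rw [det_submatrix_comp_perm_ne_zero]
    convert h1 using 3 <;> (ext a; simp)
  have := topMinor_pos_of_le hx ht h hσ hτ hle hvne
  exact (det_submatrix_comp_perm_ne_zero x _ _ σ).mp this.ne'

theorem statement8 (n : ℕ) (hn : 1 ≤ n) (u : Equiv.Perm (Fin n)) (x : Mat n) :
    x ∈ Yge u ↔ (upperUni x ∧ totNonneg x ∧ hasGauss (x * permMat u⁻¹)) := by
  rw [hasGauss_iff_topMinor_ne_zero]
  simp only [topMinor_mul_permMat]
  constructor
  · rintro ⟨v, huv, hx, ht, hv⟩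
    exact ⟨hx, ht, fun k h => topMinor_ne_zero_of_bruhatLE hx ht hv huv h⟩
  · rintro ⟨hx, ht, hg⟩
    obtain ⟨v, hv⟩ := exists_mem_doubleCosetBm x (by rw [hx.det_eq_one]; exact one_ne_zero)
    exact ⟨v, bruhatLE_of_topMinor_ne_zero hv hg, hx, ht, hv⟩

end BruhatTNN
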